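/- arXiv:1206.4799 — 3 statements merged into one kernel-verified Lean document; each statement's English description precedes it below -/
import Mathlib

section
/- Let A_1, A_2, … be a sequence of events such that P(A_n) → 0 as n → ∞. If ∑_{n=1}^∞ P(A_n ∩ A_{n+1}^c) < ∞, then P(A_n infinitely often) = 0. -/
open MeasureTheory Filter

/-- A point lying in infinitely many of the sets either leaves the sequence infinitely often or
eventually stays in it. -/
theorem limsup_subset_limsup_inter_compl_succ_union {α : Type*} (A : ℕ → Set α) :
    limsup A atTop ⊆
      limsup (fun n => A n ∩ (A (n + 1))ᶜ) atTop ∪ ⋃ N, ⋂ n ≥ N, A n := by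
  intro x hx
  rw [mem_limsup_iff_frequently_mem] at hx
  refine or_iff_not_imp_left.2 fun hB => ?_
  rw [mem_limsup_iff_frequently_mem, not_frequently, eventually_atTop] at hB
  obtain ⟨N, hN⟩ := hB
  obtain ⟨m, hm, hxm⟩ := frequently_atTop.1 hx N
  simp only [Set.mem_iUnion, Set.mem_iInter]
  refine ⟨m, fun n hn => ?_⟩
  induction n, hn using Nat.le_induction with
  | base => exact hxm
  | succ k hk ih => exact not_not.1 fun h => hN k (hm.trans hk) ⟨ih, h⟩

/-- Barndorff-Nielsen's generalization of the first Borel-Cantelli lemma: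
if `P(A n) → 0` and `∑ P(A n ∩ (A (n+1))ᶜ) < ∞`, then `P(A n i.o.) = 0`. -/
theorem barndorff_nielsen {Ω : Type*} [MeasurableSpace Ω] (μ : Measure Ω)
    [IsProbabilityMeasure μ] (A : ℕ → Set Ω) (hA : ∀ n, MeasurableSet (A n))
    (h0 : Tendsto (fun n => μ (A n)) atTop (nhds 0))
    (hsum : ∑' n, μ (A n ∩ (A (n + 1))ᶜ) ≠ ⊤) :
    μ (Filter.limsup A Filter.atTop) = 0 := by
  refine measure_mono_null (limsup_subset_limsup_inter_compl_succ_union A)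
    (measure_union_null (measure_limsup_atTop_eq_zero hsum)
      (measure_iUnion_null fun N => le_antisymm ?_ zero_le))
  refine ge_of_tendsto h0 ((eventually_ge_atTop N).mono fun n hn => ?_)
  exact measure_mono (Set.biInter_subset_of_mem hn)
end

section
/- Let A_1, A_2, … be a sequence of events such that P(A_n) → 0 as n → ∞. If for some integer m ≥ 0 the series ∑_{n=1}^∞ P(A_n^c ∩ A_{n+1}^c ∩ … ∩ A_{n+m-1}^c ∩ A_{n+m}) converges (where for m = 0 the term is just P(A_n)), then P(A_n infinitely often) = 0. -/
open MeasureTheory Filter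

/-- If `A` occurs frequently, but from `N` on it never occurs right after `m` consecutive
non-occurrences, then it occurs in every window of length `m` that starts at or after `N`. -/
theorem exists_mem_window_of_frequently {p : ℕ → Prop} {m N n : ℕ} (hp : ∃ᶠ k in atTop, p k)
    (hN : ∀ k ≥ N, ¬ ((∀ i < m, ¬ p (k + i)) ∧ p (k + m))) (hn : N ≤ n) :
    ∃ i < m, p (n + i) := by
  by_contra! hwin
  have hnone : ∀ j, ¬ p (n + j) := by
    intro j
    induction j using Nat.strong_induction_on with
    | _ j ih =>
      rcases lt_or_ge j m with hj | hj
      · exact hwin j hj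
      · intro hpj
        refine hN (n + (j - m)) (by omega) ⟨fun i hi => ?_, ?_⟩
        · rw [add_assoc]
          exact ih _ (by omega)
        · rwa [add_assoc, Nat.sub_add_cancel hj]
  obtain ⟨k, hk, hpk⟩ := frequently_atTop.1 hp n
  exact hnone (k - n) (by rwa [Nat.add_sub_cancel' hk])

/-- The liminf of a sequence of sets whose measures tend to zero is a null set. -/
theorem measure_liminf_eq_zero_of_tendsto_zero {Ω : Type*} [MeasurableSpace Ω] {μ : Measure Ω}
    {s : ℕ → Set Ω} (hs : Tendsto (fun n => μ (s n)) atTop (nhds 0)) :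
    μ (liminf s atTop) = 0 := by
  rw [liminf_eq_iSup_iInf_of_nat]
  simp only [Set.iSup_eq_iUnion, Set.iInf_eq_iInter]
  refine measure_iUnion_null fun N => le_antisymm (ge_of_tendsto hs ?_) zero_le
  filter_upwards [eventually_ge_atTop N] with n hn
  exact measure_mono (Set.biInter_subset_of_mem hn)

/-- Balakrishnan-Stepanov generalization of the first Borel-Cantelli lemma:
if `P(A n) → 0` and for some `m ≥ 0` the series
`∑ P((A n)ᶜ ∩ ⋯ ∩ (A (n+m-1))ᶜ ∩ A (n+m))` converges (for `m = 0` the term is `P(A n)`),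
then `P(A n i.o.) = 0`. -/
theorem balakrishnan_stepanov {Ω : Type*} [MeasurableSpace Ω] (μ : Measure Ω)
    [IsProbabilityMeasure μ] (A : ℕ → Set Ω) (hA : ∀ n, MeasurableSet (A n))
    (h0 : Tendsto (fun n => μ (A n)) atTop (nhds 0))
    (hsum : ∃ m : ℕ, ∑' n, μ ((⋂ i ∈ Finset.range m, (A (n + i))ᶜ) ∩ A (n + m)) ≠ ⊤) :
    μ (Filter.limsup A Filter.atTop) = 0 := by
  obtain ⟨m, hm⟩ := hsum
  have hwindow : Tendsto (fun n => μ (⋃ i ∈ Finset.range m, A (n + i))) atTop (nhds 0) := by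
    have hfin : Tendsto (fun n => ∑ i ∈ Finset.range m, μ (A (n + i))) atTop (nhds 0) := by
      simpa using tendsto_finsetSum (Finset.range m)
        fun i _ => h0.comp (tendsto_add_atTop_nat i)
    exact tendsto_of_tendsto_of_tendsto_of_le_of_le tendsto_const_nhds hfin (fun _ => zero_le)
      fun n => measure_biUnion_finset_le _ _
  refine measure_mono_null ?_ (measure_union_null (measure_limsup_atTop_eq_zero hm)
    (measure_liminf_eq_zero_of_tendsto_zero hwindow))
  intro ω hω
  rw [mem_limsup_iff_frequently_mem] at hω
  refine or_iff_not_imp_left.2 fun hB => ?_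
  rw [mem_limsup_iff_frequently_mem, not_frequently, eventually_atTop] at hB
  obtain ⟨N, hN⟩ := hB
  rw [mem_liminf_iff_eventually_mem, eventually_atTop]
  refine ⟨N, fun n hn => ?_⟩
  have hwin := exists_mem_window_of_frequently (m := m) hω
    (fun k hk => by simpa using hN k hk) hn
  simpa using hwin
end

section
/- Let A_1, A_2, … be a sequence of events such that P(A_n) → 0 as n → ∞. Suppose that ∑_{n=1}^∞ P(A_n) = ∞, that for some k ≥ 1 one has ∑_{n=1}^∞ P(A_n ∩ A_{n+k}) = ∞, and that ∑_{n=1}^∞ [P(A_n) − P(A_n ∩ A_{n+1})] < ∞. Then P(A_n infinitely often) = 0. -/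
open MeasureTheory Filter

/-- A point eventually in all sets of a sequence whose measures tend to zero lies in a null set. -/
theorem measure_setOf_eventually_mem_eq_zero {Ω : Type*} [MeasurableSpace Ω] {μ : Measure Ω}
    {A : ℕ → Set Ω} (h0 : Tendsto (fun n => μ (A n)) atTop (nhds 0)) :
    μ {ω | ∀ᶠ n in atTop, ω ∈ A n} = 0 := by
  have hset : {ω | ∀ᶠ n in atTop, ω ∈ A n} = ⋃ N, ⋂ m ≥ N, A m := by
    ext ω
    simp
  rw [hset, measure_iUnion_null_iff]
  intro N
  refine le_antisymm (ge_of_tendsto h0 ?_) zero_le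
  filter_upwards [eventually_ge_atTop N] with m hm
  exact measure_mono (Set.biInter_subset_of_mem hm)

/-- If a sequence of events is left only finitely often, a point lying in infinitely many of them
lies in all but finitely many. -/
theorem eventually_mem_of_frequently_mem {Ω : Type*} {A : ℕ → Set Ω} {ω : Ω}
    (hleave : ∀ᶠ n in atTop, ω ∉ A n \ A (n + 1)) (hfreq : ∃ᶠ n in atTop, ω ∈ A n) :
    ∀ᶠ n in atTop, ω ∈ A n := by
  obtain ⟨N, hN⟩ := eventually_atTop.1 hleave
  obtain ⟨m, hm, hmA⟩ := frequently_atTop.1 hfreq N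
  refine eventually_atTop.2 ⟨m, fun n hn => ?_⟩
  induction n, hn using Nat.le_induction with
  | base => exact hmA
  | succ n hn ih => exact by_contra fun h => hN n (hm.trans hn) ⟨ih, h⟩

/-- Stepanov's generalization of the first Borel-Cantelli lemma:
if `P(A n) → 0`, `∑ P(A n) = ∞`, for some `k ≥ 1` one has `∑ P(A n ∩ A (n+k)) = ∞`,
and `∑ (P(A n) - P(A n ∩ A (n+1))) < ∞`, then `P(A n i.o.) = 0`. -/
theorem stepanov_generalization {Ω : Type*} [MeasurableSpace Ω] (μ : Measure Ω)
    [IsProbabilityMeasure μ] (A : ℕ → Set Ω) (hA : ∀ n, MeasurableSet (A n))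
    (h0 : Tendsto (fun n => μ (A n)) atTop (nhds 0))
    (hdiv : ∑' n, μ (A n) = ⊤)
    (hdiv' : ∃ k : ℕ, 1 ≤ k ∧ ∑' n, μ (A n ∩ A (n + k)) = ⊤)
    (hconv : ∑' n, (μ (A n) - μ (A n ∩ A (n + 1))) ≠ ⊤) :
    μ (Filter.limsup A Filter.atTop) = 0 := by
  have hdiff : ∑' n, μ (A n \ A (n + 1)) ≠ ⊤ := by
    convert hconv using 3 with n
    rw [← Set.sdiff_self_inter,
      measure_sdiff Set.inter_subset_left ((hA n).inter (hA (n + 1))).nullMeasurableSet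
        (measure_ne_top μ _)]
  have hev : ∀ᵐ ω ∂μ, ¬ ∀ᶠ n in atTop, ω ∈ A n := by
    rw [ae_iff]
    simpa using measure_setOf_eventually_mem_eq_zero h0
  rw [measure_eq_zero_iff_ae_notMem]
  filter_upwards [ae_eventually_notMem hdiff, hev] with ω hleave hω hmem
  exact hω (eventually_mem_of_frequently_mem hleave (mem_limsup_iff_frequently_mem.1 hmem))
end
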